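/- Let r ≥ 2 be an integer and δ > 0. There exists a constant C = C(r, δ) such that, for all sufficiently large n, there exists an (r+1)-saturated graph G on n vertices with e(G) ≥ t_r(n) − C·n^{(r+1)/r} that contains no copy of the Turán graph T_r(δ·r·n) as a subgraph. -/

import Mathlib

open SimpleGraph Finset
open scoped Classical

/-- `t_r(n)`: the number of edges of the `r`-partite Turán graph on `n` vertices. -/
noncomputable def turanEdges (r n : ℕ) : ℕ := (SimpleGraph.turanGraph n r).edgeFinset.card

/-- A graph is `k`-saturated (maximal `K_k`-free) if it is `K_k`-free but adding any edge of
the complement creates a `K_k`. -/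
def Saturated {V : Type} (k : ℕ) (G : SimpleGraph V) : Prop :=
  G.CliqueFree k ∧
    ∀ v w : V, v ≠ w → ¬ G.Adj v w →
      ¬ (G ⊔ SimpleGraph.fromEdgeSet {s(v, w)}).CliqueFree k

theorem exists_not_adj_of_cliqueFree {V α : Type*} [Fintype α] {k : ℕ} {G : SimpleGraph V}
    (hG : G.CliqueFree k) (hα : Fintype.card α = k) (g : α → V) :
    ∃ i j, i ≠ j ∧ ¬ G.Adj (g i) (g j) := by
  by_contra! h
  have hinj : Function.Injective g := by
    intro i j hij
    by_contra hne
    have := h i j hne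
    rw [hij] at this
    exact G.loopless.irrefl _ this
  refine hG (univ.image g) ⟨?_, ?_⟩
  · intro x hx y hy hxy
    simp only [coe_image, coe_univ, Set.image_univ, Set.mem_range] at hx hy
    obtain ⟨i, rfl⟩ := hx
    obtain ⟨j, rfl⟩ := hy
    exact h i j (fun e => hxy (by rw [e]))
  · rw [card_image_of_injective _ hinj, card_univ, hα]

theorem exists_saturated_ge {V : Type} [Finite V] {k : ℕ} {G₀ : SimpleGraph V}
    (h : G₀.CliqueFree k) : ∃ G, G₀ ≤ G ∧ Saturated k G := by
  obtain ⟨G, hle, hmax⟩ :=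
    Finite.exists_le_maximal (p := fun G : SimpleGraph V => G.CliqueFree k) h
  refine ⟨G, hle, hmax.prop, fun v w hvw hadj hfree => hadj ?_⟩
  refine hmax.le_of_ge hfree le_sup_left ?_
  simp [hvw]

/-- Vertices `v` with `d v = none` are ordinary: they carry a colour `c v`, and the colours `c₀`
and `c₁` carry labels `φ v` and `f v s`. Vertices with `d v = some (s, t, j)` are special:
their ordinary neighbours are determined by the `t`-th coordinate of the labels. -/
structure LabelledColouring (V ι S T J : Type*) where
  c : V → ι
  c₀ : ι
  c₁ : ι
  ne : c₀ ≠ c₁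
  φ : V → T → J
  f : V → S → T → J
  d : V → Option (S × T × J)

namespace LabelledColouring

variable {V ι S T J : Type*} (D : LabelledColouring V ι S T J)

/-- An ordinary pair of colours `c₀` and `c₁` that shares a label. -/
def Clash (u v : V) : Prop := D.c u = D.c₀ ∧ D.c v = D.c₁ ∧ ∃ s, D.φ u = D.f v s

/-- Adjacency of a special vertex with label `x` to an ordinary vertex. -/
def Attached (x : S × T × J) (v : V) : Prop :=
  (D.c v = D.c₀ ∧ D.φ v x.2.1 = x.2.2) ∨ (D.c v = D.c₁ ∧ D.f v x.1 x.2.1 = x.2.2)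

/-- The complete multipartite graph on the ordinary vertices with clashing pairs removed,
together with the special vertices. -/
def graph : SimpleGraph V where
  Adj u v := match D.d u, D.d v with
    | none, none => D.c u ≠ D.c v ∧ ¬ D.Clash u v ∧ ¬ D.Clash v u
    | some x, some y => x.1 = y.1 ∧ x.2.1 ≠ y.2.1
    | some x, none => D.Attached x v
    | none, some y => D.Attached y u
  symm := ⟨by
    intro u v h
    rcases hu : D.d u with _ | x <;> rcases hv : D.d v with _ | y <;>
      simp only [hu, hv] at h ⊢
    · exact ⟨h.1.symm, h.2.2, h.2.1⟩
    · exact h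
    · exact h
    · exact ⟨h.1.symm, h.2.symm⟩⟩
  loopless := ⟨by
    intro u h
    rcases hu : D.d u with _ | x <;> simp [hu] at h⟩

variable {D} {u v : V} {x y : S × T × J}

theorem adj_none_none (hu : D.d u = none) (hv : D.d v = none) :
    D.graph.Adj u v ↔ D.c u ≠ D.c v ∧ ¬ D.Clash u v ∧ ¬ D.Clash v u := by
  simp [graph, hu, hv]

theorem adj_some_some (hu : D.d u = some x) (hv : D.d v = some y) :
    D.graph.Adj u v ↔ x.1 = y.1 ∧ x.2.1 ≠ y.2.1 := by
  simp [graph, hu, hv]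

theorem adj_some_none (hu : D.d u = some x) (hv : D.d v = none) :
    D.graph.Adj u v ↔ D.Attached x v := by
  simp [graph, hu, hv]

variable (D) in
theorem graph_cliqueFree [Fintype ι] [Fintype T] {r : ℕ} (hι : Fintype.card ι = r)
    (hT : Fintype.card T + 1 = r) : D.graph.CliqueFree (r + 1) := by
  by_contra hcl
  let g := topEmbeddingOfNotCliqueFree hcl
  have hadj : ∀ i j, i ≠ j → D.graph.Adj (g i) (g j) := fun i j hij => g.map_adj_iff.2 hij
  by_cases hall : ∀ i, D.d (g i) = none
  · have hinj : Function.Injective fun i => D.c (g i) := by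
      intro i j hij
      by_contra hne
      exact ((adj_none_none (hall i) (hall j)).1 (hadj i j hne)).1 hij
    have := Fintype.card_le_of_injective _ hinj
    simp [hι] at this
  · push Not at hall
    obtain ⟨i₀, hi₀⟩ := hall
    obtain ⟨⟨s, t₀, j₀⟩, hx⟩ := Option.ne_none_iff_exists'.1 hi₀
    have hsome : ∀ i x, D.d (g i) = some x → x.1 = s := by
      intro i x hi
      by_cases h : i = i₀
      · subst h; rw [hx] at hi; cases hi; rfl
      · exact ((adj_some_some hi hx).1 (hadj i i₀ h)).1
    have hnone : ∀ i, D.d (g i) = none → D.c (g i) = D.c₀ ∨ D.c (g i) = D.c₁ := by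
      intro i hi
      have h : i₀ ≠ i := fun e => hi₀ (e ▸ hi)
      exact ((adj_some_none hx hi).1 (hadj i₀ i h)).imp And.left And.left
    let colour : Fin (r + 1) → T ⊕ Bool := fun i =>
      match D.d (g i) with
      | none => .inr (decide (D.c (g i) = D.c₀))
      | some x => .inl x.2.1
    have hinj : Function.Injective colour := by
      intro i j hij
      by_contra hne
      have ha := hadj i j hne
      rcases hi : D.d (g i) with _ | x <;> rcases hj : D.d (g j) with _ | y <;>
        simp only [colour, hi, hj, reduceCtorEq, Sum.inr.injEq, Sum.inl.injEq,
          decide_eq_decide] at hij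
      · have hcne := ((adj_none_none hi hj).1 ha).1
        rcases hnone i hi with h1 | h1 <;> rcases hnone j hj with h2 | h2 <;>
          simp_all
      · exact ((adj_some_some hi hj).1 ha).2 hij
    have hbij : Function.Bijective colour :=
      (Fintype.bijective_iff_injective_and_card _).2 ⟨hinj, by simp; omega⟩
    obtain ⟨a, ha⟩ := hbij.2 (.inr true)
    obtain ⟨b, hb⟩ := hbij.2 (.inr false)
    have hda : D.d (g a) = none := by
      rcases h : D.d (g a) with _ | x <;> simp [colour, h] at ha ⊢
    have hdb : D.d (g b) = none := by
      rcases h : D.d (g b) with _ | x <;> simp [colour, h] at hb ⊢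
    have hca : D.c (g a) = D.c₀ := by simpa [colour, hda] using ha
    have hcb : D.c (g b) = D.c₁ := by
      have : D.c (g b) ≠ D.c₀ := by simpa [colour, hdb] using hb
      exact (hnone b hdb).resolve_left this
    have hab : a ≠ b := fun h => D.ne (by rw [← hca, ← hcb, h])
    refine ((adj_none_none hda hdb).1 (hadj a b hab)).2.1 ⟨hca, hcb, s, funext fun t => ?_⟩
    obtain ⟨i, hi⟩ := hbij.2 (.inl t)
    obtain ⟨x, hxi, rfl⟩ : ∃ x, D.d (g i) = some x ∧ x.2.1 = t := by
      rcases h : D.d (g i) with _ | x <;> simp [colour, h] at hi ⊢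
      exact hi
    have hia : i ≠ a := by rintro rfl; simp [hda] at hxi
    have hib : i ≠ b := by rintro rfl; simp [hdb] at hxi
    have h1 := (adj_some_none hxi hda).1 (hadj i a hia)
    have h2 := (adj_some_none hxi hdb).1 (hadj i b hib)
    have hs := hsome i x hxi
    simp only [Attached, hca, hcb, D.ne, D.ne.symm, true_and, false_and, or_false, false_or,
      hs] at h1 h2
    rw [h1, h2]

theorem not_adj_of_clash [Fintype T] {r : ℕ} (hT : Fintype.card T + 1 = r)
    {G : SimpleGraph V} (hG : D.graph ≤ G) (hfree : G.CliqueFree (r + 1))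
    (hd : ∀ x, ∃ v, D.d v = some x) (hu : D.d u = none) (hv : D.d v = none)
    (h : D.Clash u v) : ¬ G.Adj u v := by
  intro huv
  obtain ⟨hcu, hcv, s, hs⟩ := h
  choose w hw using hd
  let g : Option (Option T) → V
    | none => u
    | some none => v
    | some (some t) => w (s, t, D.φ u t)
  have hwu : ∀ t, G.Adj (w (s, t, D.φ u t)) u := fun t =>
    hG ((adj_some_none (hw _) hu).2 (Or.inl ⟨hcu, rfl⟩))
  have hwv : ∀ t, G.Adj (w (s, t, D.φ u t)) v := fun t =>
    hG ((adj_some_none (hw _) hv).2 (Or.inr ⟨hcv, by rw [hs]⟩))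
  obtain ⟨i, j, hij, hn⟩ := exists_not_adj_of_cliqueFree hfree (by simp [hT]) g
  rcases i with _ | _ | i <;> rcases j with _ | _ | j <;>
    simp only [g, ne_eq, not_true_eq_false, reduceCtorEq, Option.some.injEq] at hij hn
  · exact hn huv
  · exact hn (hwu j).symm
  · exact hn huv.symm
  · exact hn (hwv j).symm
  · exact hn (hwu i)
  · exact hn (hwv i)
  · exact hn (hG ((adj_some_some (hw _) (hw _)).2 ⟨rfl, hij⟩))

/-- Large sets of ordinary vertices of prescribed colours admit a clash-free system of
representatives. -/
theorem exists_transversal_not_clash [Fintype V] {α : Type*} [Fintype α] {B : ℕ}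
    (hB : ∀ v, #{u | D.Clash u v} ≤ B) (ρ : α → ι) (Q : α → Finset V)
    (hQ : ∀ i, ∀ v ∈ Q i, D.c v = ρ i) (hcard : ∀ i, Fintype.card α * B < #(Q i)) :
    ∃ g : α → V, (∀ i, g i ∈ Q i) ∧ ∀ i j, ¬ D.Clash (g i) (g j) := by
  have hne : ∀ i, ∃ v, v ∈ Q i := fun i => card_pos.1 (by have := hcard i; omega)
  choose g₁ hg₁ using hne
  have hav : ∀ i, ∃ v ∈ Q i, ∀ j, ¬ D.Clash v (g₁ j) := by
    intro i
    have hU : #(univ.biUnion fun j : α => {u | D.Clash u (g₁ j)}) < #(Q i) := by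
      refine lt_of_le_of_lt (card_biUnion_le_card_mul _ _ B fun j _ => hB _) ?_
      simpa using hcard i
    obtain ⟨v, hv, hv'⟩ := exists_mem_notMem_of_card_lt_card hU
    exact ⟨v, hv, fun j hj => hv' (by simpa using ⟨j, hj⟩)⟩
  choose g₀ hg₀ hg₀' using hav
  refine ⟨fun i => if ρ i = D.c₀ then g₀ i else g₁ i, fun i => ?_, fun i j h => ?_⟩
  · dsimp only; split_ifs
    exacts [hg₀ i, hg₁ i]
  · have hmem : ∀ i, (if ρ i = D.c₀ then g₀ i else g₁ i) ∈ Q i := fun i => by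
      split_ifs
      exacts [hg₀ i, hg₁ i]
    have hi : ρ i = D.c₀ := by rw [← hQ i _ (hmem i)]; exact h.1
    have hj : ρ j ≠ D.c₀ := by
      rw [← hQ j _ (hmem j), show D.c _ = D.c₁ from h.2.1]
      exact D.ne.symm
    simp only [hi, hj, if_true, if_false] at h
    exact hg₀' i j h

/-- Two large monochromatic sets of the same colour are not completely joined. -/
theorem exists_not_adj_of_same_colour [Fintype V] [Fintype ι] {r B : ℕ}
    (hι : Fintype.card ι = r) {G : SimpleGraph V} (hG : D.graph ≤ G)
    (hfree : G.CliqueFree (r + 1)) (hB : ∀ v, #{u | D.Clash u v} ≤ B)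
    (hclass : ∀ k, (r + 1) * B < #{v | D.d v = none ∧ D.c v = k}) (k : ι)
    {X Y : Finset V} (hX : ∀ v ∈ X, D.d v = none ∧ D.c v = k)
    (hY : ∀ v ∈ Y, D.d v = none ∧ D.c v = k) (hXc : (r + 1) * B < #X)
    (hYc : (r + 1) * B < #Y) : ∃ a ∈ X, ∃ b ∈ Y, ¬ G.Adj a b := by
  by_contra! hXY
  let ρ : Option ι → ι := fun i => i.getD k
  let Q : Option ι → Finset V
    | none => X
    | some i => if i = k then Y else ({v | D.d v = none ∧ D.c v = i} : Finset V)
  have hQ : ∀ i, ∀ v ∈ Q i, D.d v = none ∧ D.c v = ρ i := by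
    rintro (_ | i) v hv
    · exact hX v hv
    · by_cases hik : i = k
      · subst hik
        exact hY v (by simpa [Q] using hv)
      · simpa [Q, ρ, hik] using hv
  obtain ⟨g, hgQ, hg⟩ := exists_transversal_not_clash hB ρ Q (fun i v hv => (hQ i v hv).2)
    (by
      rintro (_ | i) <;> simp only [Fintype.card_option, hι, Q]
      · exact hXc
      · split_ifs
        exacts [hYc, hclass i])
  obtain ⟨i, j, hij, hn⟩ := exists_not_adj_of_cliqueFree hfree (by simp [hι]) g
  have hρ : ρ i = ρ j := by
    by_contra hne
    refine hn (hG ((adj_none_none (hQ i _ (hgQ i)).1 (hQ j _ (hgQ j)).1).2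
      ⟨?_, hg i j, hg j i⟩))
    rwa [(hQ i _ (hgQ i)).2, (hQ j _ (hgQ j)).2]
  have hmemk : g (some k) ∈ Y := by simpa [Q] using hgQ (some k)
  rcases i with _ | i <;> rcases j with _ | j <;> simp only [ρ, Option.getD] at hρ
  · exact hij rfl
  · subst hρ
    exact hn (hXY _ (hgQ none) _ hmemk)
  · subst hρ
    exact hn (hXY _ (hgQ none) _ hmemk).symm
  · exact hij (by rw [hρ])

/-- If large sets of colours `c₀` and `c₁` always clash, a `K_{r+1}`-free graph containing
`D.graph` does not contain a complete `r`-partite graph with large parts. -/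
theorem not_exists_complete_multipartite [Fintype V] [Fintype ι] [Fintype T] {r B : ℕ} {ε : ℝ}
    (hι : Fintype.card ι = r) (hT : Fintype.card T + 1 = r) {G : SimpleGraph V}
    (hG : D.graph ≤ G) (hfree : G.CliqueFree (r + 1)) (hd : ∀ x, ∃ v, D.d v = some x)
    (hB : ∀ v, #{u | D.Clash u v} ≤ B)
    (hclass : ∀ k, (r + 1) * B < #{v | D.d v = none ∧ D.c v = k})
    (hclash : ∀ X Y : Finset V, ε ≤ #X → ε ≤ #Y → ∃ a ∈ X, ∃ b ∈ Y, ∃ s, D.φ a = D.f b s)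
    (hε : ((r + 1) * B : ℕ) < ε) (P : Fin r → Finset V)
    (hP : ∀ i j, i ≠ j → ∀ a ∈ P i, ∀ b ∈ P j, G.Adj a b)
    (hPc : ∀ i, r * ε + #{v | D.d v ≠ none} ≤ #(P i)) : False := by
  have hr : 0 < r := by omega
  have hmono : ∀ i, ∃ k, ε ≤ #{v ∈ P i | D.d v = none ∧ D.c v = k} := by
    intro i
    by_contra! h
    have h1 : #(P i) ≤ #{v | D.d v ≠ none} + ∑ k : ι, #{v ∈ P i | D.d v = none ∧ D.c v = k} := by
      refine le_trans (card_le_card (t := ({v | D.d v ≠ none} : Finset V) ∪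
        univ.biUnion fun k : ι => {v ∈ P i | D.d v = none ∧ D.c v = k}) ?_) ?_
      · intro v hv
        by_cases hdv : D.d v = none <;> simp [hdv, hv]
      · exact (card_union_le _ _).trans (Nat.add_le_add_left card_biUnion_le _)
    have h2 : ∑ k : ι, (#{v ∈ P i | D.d v = none ∧ D.c v = k} : ℝ) < ∑ k : ι, ε :=
      sum_lt_sum_of_nonempty ⟨D.c₀, mem_univ _⟩ fun k _ => h k
    rw [sum_const, card_univ, hι, nsmul_eq_mul] at h2
    have h3 : (#(P i) : ℝ) ≤ #{v | D.d v ≠ none} +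
        ∑ k : ι, (#{v ∈ P i | D.d v = none ∧ D.c v = k} : ℝ) := by exact_mod_cast h1
    linarith [hPc i]
  choose κ hκ using hmono
  have hbig : ∀ i, (r + 1) * B < #{v ∈ P i | D.d v = none ∧ D.c v = κ i} := fun i => by
    exact_mod_cast hε.trans_le (hκ i)
  have hinj : Function.Injective κ := by
    intro i j hij
    by_contra hne
    obtain ⟨a, ha, b, hb, hab⟩ := exists_not_adj_of_same_colour hι hG hfree hB hclass (κ i)
      (X := {v ∈ P i | D.d v = none ∧ D.c v = κ i})
      (Y := {v ∈ P j | D.d v = none ∧ D.c v = κ j})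
      (fun v hv => (mem_filter.1 hv).2) (fun v hv => hij ▸ (mem_filter.1 hv).2)
      (hbig i) (hbig j)
    exact hab (hP i j hne a (mem_filter.1 ha).1 b (mem_filter.1 hb).1)
  have hsurj : Function.Surjective κ :=
    ((Fintype.bijective_iff_injective_and_card _).2 ⟨hinj, by simp [hι]⟩).2
  obtain ⟨i, hi⟩ := hsurj D.c₀
  obtain ⟨j, hj⟩ := hsurj D.c₁
  have hij : i ≠ j := fun h => D.ne (by rw [← hi, ← hj, h])
  obtain ⟨a, ha, b, hb, s, hs⟩ := hclash _ _ (hκ i) (hκ j)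
  rw [mem_filter] at ha hb
  exact not_adj_of_clash hT hG hfree hd ha.2.1 hb.2.1
    ⟨ha.2.2.trans hi, hb.2.2.trans hj, s, hs⟩ (hP i j hij a ha.1 b hb.1)

/-- Few edges of the complete multipartite graph are missing from `D.graph`. -/
theorem card_edgeFinset_le_add [Fintype V] {B : ℕ} (hB : ∀ v, #{u | D.Clash u v} ≤ B)
    {H : SimpleGraph V} [Fintype H.edgeSet] (hH : ∀ u v, H.Adj u v → D.c u ≠ D.c v) :
    #H.edgeFinset ≤ #D.graph.edgeFinset +
      (#{v | D.d v ≠ none} * Fintype.card V + Fintype.card V * B) := by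
  let E₁ : Finset (V × V) := ({v | D.d v ≠ none} : Finset V) ×ˢ univ
  let E₂ : Finset (V × V) := univ.biUnion fun v : V =>
    ({u | D.Clash u v} : Finset V).image fun u => (u, v)
  have hE₁ : #E₁ = #{v | D.d v ≠ none} * Fintype.card V := by simp [E₁, card_product]
  have hE₂ : #E₂ ≤ Fintype.card V * B := by
    refine card_biUnion_le_card_mul _ _ B fun v _ => card_image_le.trans (hB v)
  have hsub : H.edgeFinset ⊆ D.graph.edgeFinset ∪ (E₁ ∪ E₂).image fun p => s(p.1, p.2) := by
    intro e
    induction e using Sym2.ind with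
    | _ u v =>
      intro he
      rw [mem_edgeFinset, mem_edgeSet] at he
      rw [mem_union, mem_edgeFinset, mem_edgeSet, or_iff_not_imp_left]
      intro hn
      simp only [mem_image, mem_union, Prod.exists, E₁, E₂, mem_product, mem_filter, mem_univ,
        true_and, and_true, mem_biUnion, Prod.mk.injEq]
      by_cases hu : D.d u = none
      · by_cases hv : D.d v = none
        · rw [adj_none_none hu hv] at hn
          by_cases h1 : D.Clash u v
          · exact ⟨u, v, Or.inr ⟨v, u, h1, rfl, rfl⟩, rfl⟩
          · by_cases h2 : D.Clash v u
            · exact ⟨v, u, Or.inr ⟨u, v, h2, rfl, rfl⟩, Sym2.eq_swap⟩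
            · exact absurd ⟨hH u v he, h1, h2⟩ hn
        · exact ⟨v, u, Or.inl hv, Sym2.eq_swap⟩
      · exact ⟨u, v, Or.inl hu, rfl⟩
  refine (card_le_card hsub).trans ((card_union_le _ _).trans (Nat.add_le_add_left ?_ _))
  refine card_image_le.trans ((card_union_le _ _).trans ?_)
  rw [hE₁]
  exact Nat.add_le_add_left hE₂ _

end LabelledColouring

theorem exists_labelling_hitting {Γ S : Type*} [Fintype Γ] [Fintype S] {n : ℕ} {η ε : ℝ}
    (hpos : 0 < Fintype.card Γ) (hle : Fintype.card Γ ≤ n) (hη : 0 ≤ η)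
    (hK : 2 ≤ η * ε * Fintype.card S) :
    ∃ f : Fin n → S → Γ, ∀ (X : Finset Γ) (Y : Finset (Fin n)),
      η * Fintype.card Γ ≤ #X → ε * n ≤ #Y → ∃ y ∈ Y, ∃ s, f y s ∈ X := by
  by_contra! hbad
  set K := Fintype.card S with hKS
  set M := Fintype.card Γ with hM
  have hn : 0 < n := hpos.trans_le hle
  let bad : Finset Γ × Finset (Fin n) → Finset (Fin n × S → Γ) := fun P =>
    Fintype.piFinset fun p => if p.1 ∈ P.2 then P.1ᶜ else univ
  let W : Finset (Finset Γ × Finset (Fin n)) := {P | η * M ≤ #P.1 ∧ ε * n ≤ #P.2}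
  have hcover : (univ : Finset (Fin n × S → Γ)) ⊆ W.biUnion bad := by
    intro f _
    obtain ⟨X, Y, hX, hY, h⟩ := hbad fun y s => f (y, s)
    refine mem_biUnion.2 ⟨(X, Y), by simp [W, hX, hY], ?_⟩
    rw [Fintype.mem_piFinset]
    rintro ⟨y, s⟩
    by_cases hy : y ∈ Y
    · simpa [hy] using h y hy s
    · simp [hy]
  have hW : (#W : ℝ) ≤ 4 ^ n := by
    have h1 : #W ≤ 2 ^ M * 2 ^ n := by
      refine (card_le_univ W).trans ?_
      simp [Fintype.card_prod, Fintype.card_finset, hM]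
    have h2 : 2 ^ M * 2 ^ n ≤ 4 ^ n := by
      calc 2 ^ M * 2 ^ n ≤ 2 ^ n * 2 ^ n :=
            Nat.mul_le_mul_right _ (Nat.pow_le_pow_right (by norm_num) hle)
        _ = 4 ^ n := by rw [← mul_pow]; norm_num
    exact_mod_cast h1.trans h2
  have hbadcard : ∀ P ∈ W, (#(bad P) : ℝ) ≤ (M : ℝ) ^ (n * K) * Real.exp (-(2 * n)) := by
    rintro ⟨X, Y⟩ hP
    obtain ⟨hX, hY⟩ : η * M ≤ #X ∧ ε * n ≤ #Y := by simpa [W] using hP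
    have hfac : ∀ p : Fin n × S, ((#(if p.1 ∈ Y then Xᶜ else univ) : ℕ) : ℝ) ≤
        M * (if p.1 ∈ Y then Real.exp (-η) else 1) := by
      intro p
      split_ifs
      · rw [card_compl, Nat.cast_sub (card_le_univ X), ← hM]
        have := Real.add_one_le_exp (-η)
        have hM0 : (0 : ℝ) ≤ M := Nat.cast_nonneg _
        nlinarith [mul_le_mul_of_nonneg_left this hM0]
      · simp [hM]
    have hcount : #{p : Fin n × S | p.1 ∈ Y} = #Y * K := by
      rw [show ({p : Fin n × S | p.1 ∈ Y} : Finset _) = Y ×ˢ univ by ext; simp]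
      simp [card_product, hKS]
    calc (#(bad (X, Y)) : ℝ)
        = ∏ p : Fin n × S, ((#(if p.1 ∈ Y then Xᶜ else univ) : ℕ) : ℝ) := by
          simp only [bad, Fintype.card_piFinset, Nat.cast_prod]
      _ ≤ ∏ p : Fin n × S, (M * (if p.1 ∈ Y then Real.exp (-η) else 1) : ℝ) :=
          prod_le_prod (fun _ _ => Nat.cast_nonneg _) fun p _ => hfac p
      _ = (M : ℝ) ^ (n * K) * Real.exp (-η) ^ (#Y * K) := by
          rw [prod_mul_distrib, ← hcount, prod_ite]
          simp [hKS]
      _ ≤ (M : ℝ) ^ (n * K) * Real.exp (-(2 * n)) := by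
          refine mul_le_mul_of_nonneg_left ?_ (by positivity)
          rw [← Real.exp_nat_mul]
          refine Real.exp_le_exp.2 ?_
          push_cast
          have h1 : η * K * (ε * n) ≤ η * K * #Y :=
            mul_le_mul_of_nonneg_left hY (by positivity)
          have h2 : 2 * (n : ℝ) ≤ η * ε * K * n :=
            mul_le_mul_of_nonneg_right hK (Nat.cast_nonneg _)
          linarith
  have htotal : (M : ℝ) ^ (n * K) ≤ 4 ^ n * ((M : ℝ) ^ (n * K) * Real.exp (-(2 * n))) := by
    have h1 : M ^ (n * K) ≤ ∑ P ∈ W, #(bad P) := by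
      refine le_trans (le_of_eq ?_) ((card_le_card hcover).trans card_biUnion_le)
      simp [hM, hKS]
    calc (M : ℝ) ^ (n * K) ≤ ∑ P ∈ W, (#(bad P) : ℝ) := by exact_mod_cast h1
      _ ≤ #W * ((M : ℝ) ^ (n * K) * Real.exp (-(2 * n))) := by
          rw [← nsmul_eq_mul]
          exact sum_le_card_nsmul _ _ _ hbadcard
      _ ≤ _ := mul_le_mul_of_nonneg_right hW (by positivity)
  have hexp : (4 : ℝ) ^ n * Real.exp (-(2 * n)) < 1 := by
    have h4 : 4 * Real.exp (-2) < 1 := by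
      rw [Real.exp_neg, ← div_eq_mul_inv, div_lt_one (Real.exp_pos _)]
      have := Real.exp_one_gt_d9
      rw [show (2 : ℝ) = 1 + 1 by norm_num, Real.exp_add]
      nlinarith
    rw [show -(2 * (n : ℝ)) = n * (-2) by ring, Real.exp_nat_mul, ← mul_pow]
    exact pow_lt_one₀ (by positivity) h4 hn.ne'
  have hMpos : (0 : ℝ) < (M : ℝ) ^ (n * K) := by positivity
  nlinarith [mul_lt_mul_of_pos_left hexp hMpos]

theorem exists_map_card_fiber_le {Γ : Type*} [Fintype Γ] [DecidableEq Γ] {n q : ℕ}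
    (h : n ≤ q * Fintype.card Γ) :
    ∃ φ : Fin n → Γ, ∀ x, #{v | φ v = x} ≤ q := by
  let e := Fintype.equivFin Γ
  refine ⟨fun v => e.symm ⟨v / q, Nat.div_lt_of_lt_mul (v.2.trans_le h)⟩, fun x => ?_⟩
  rcases Nat.eq_zero_or_pos q with rfl | hq
  · have : n = 0 := by simpa using h
    subst this
    simp
  conv_rhs => rw [← card_range q]
  refine card_le_card_of_injOn (fun v => (v : ℕ) % q) (fun v _ => by simpa using Nat.mod_lt _ hq) ?_
  intro u hu v hv huv
  have hu' : (u : ℕ) / q = e x := by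
    have := (mem_filter.1 hu).2
    rw [Equiv.symm_apply_eq] at this
    rw [← this]
  have hv' : (v : ℕ) / q = e x := by
    have := (mem_filter.1 hv).2
    rw [Equiv.symm_apply_eq] at this
    rw [← this]
  refine Fin.ext ?_
  rw [← Nat.div_add_mod (u : ℕ) q, ← Nat.div_add_mod (v : ℕ) q, hu', hv']
  exact congrArg _ huv

theorem exists_partial_labelling {α : Type*} [Fintype α] {n : ℕ} (h : Fintype.card α ≤ n) :
    ∃ d : Fin n → Option α, (∀ x, ∃ v, d v = some x) ∧ #{v | d v ≠ none} ≤ Fintype.card α := by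
  obtain ⟨e⟩ := Function.Embedding.nonempty_of_card_le (α := α) (β := Fin n) (by simpa using h)
  refine ⟨Function.partialInv e, fun x => ⟨e x, Function.partialInv_left e.injective x⟩, ?_⟩
  refine (card_le_card (t := univ.image e) ?_).trans card_image_le
  intro v hv
  obtain ⟨x, hx⟩ := Option.ne_none_iff_exists'.1 (mem_filter.1 hv).2
  exact mem_image.2 ⟨x, mem_univ _, (e.injective.isPartialInv x v).1 hx⟩

theorem div_le_card_mod_eq (n : ℕ) {r k : ℕ} (hk : k < r) :
    n / r ≤ #{v : Fin n | (v : ℕ) % r = k} := by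
  have hlt : ∀ j : Fin (n / r), r * j + k < n := fun j =>
    calc r * j + k < r * j + r := by omega
      _ = r * (j + 1) := by ring
      _ ≤ r * (n / r) := Nat.mul_le_mul_left _ j.2
      _ ≤ n := Nat.mul_div_le _ _
  calc n / r = #(univ : Finset (Fin (n / r))) := by simp
    _ ≤ _ := by
      refine card_le_card_of_injOn (fun j => (⟨r * j + k, hlt j⟩ : Fin n)) ?_ ?_
      · intro j _
        simp [Nat.mod_eq_of_lt hk]
      · intro i _ j _ hij
        have : r * (i : ℕ) = r * j := by simpa using hij
        exact Fin.ext (Nat.eq_of_mul_eq_mul_left (by omega) this)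

theorem exists_forall_mul_add_one_lt (c : ℝ) {σ : ℝ} (hσ : 0 < σ) :
    ∃ N : ℕ, 0 < N ∧ ∀ n m : ℕ, N ≤ n → 0 < m → m ^ 2 ≤ n → c * (m + 1) < σ * n := by
  refine ⟨⌈4 * c ^ 2 / σ ^ 2⌉₊ + 1, by omega, fun n m hN hm hmn => ?_⟩
  have h1 : 4 * c ^ 2 < σ ^ 2 * n := by
    have : 4 * c ^ 2 / σ ^ 2 < n :=
      (Nat.le_ceil _).trans_lt (by exact_mod_cast (Nat.lt_of_succ_le hN))
    rw [div_lt_iff₀ (by positivity)] at this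
    linarith
  have hn : (0 : ℝ) < n := by
    have : 0 < n := by omega
    exact_mod_cast this
  have hm' : (1 : ℝ) ≤ m := by exact_mod_cast hm
  have hmn' : (m : ℝ) ^ 2 ≤ n := by exact_mod_cast hmn
  refine lt_of_pow_lt_pow_left₀ 2 (by positivity) ?_
  calc (c * (m + 1)) ^ 2 = c ^ 2 * (m + 1) ^ 2 := by ring
    _ ≤ c ^ 2 * (4 * n) := by
      refine mul_le_mul_of_nonneg_left ?_ (sq_nonneg c)
      nlinarith
    _ = 4 * c ^ 2 * n := by ring
    _ < σ ^ 2 * n * n := mul_lt_mul_of_pos_right h1 hn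
    _ = (σ * n) ^ 2 := by ring

theorem exists_nat_root {r n : ℕ} (hr : 0 < r) (hn : 0 < n) :
    ∃ m : ℕ, 0 < m ∧ m ^ r ≤ n ∧ n ≤ 2 ^ r * m ^ r ∧
      (n : ℝ) * m ≤ (n : ℝ) ^ (((r : ℝ) + 1) / r) := by
  have hr' : (r : ℝ) ≠ 0 := by positivity
  have hn' : (0 : ℝ) < n := by exact_mod_cast hn
  set x : ℝ := (n : ℝ) ^ (1 / (r : ℝ)) with hx
  have hxr : x ^ r = n := by
    rw [hx, ← Real.rpow_natCast, ← Real.rpow_mul hn'.le, one_div_mul_cancel hr', Real.rpow_one]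
  have hx1 : 1 ≤ x := Real.one_le_rpow (by exact_mod_cast hn) (by positivity)
  have hm : (⌊x⌋₊ : ℝ) ≤ x := Nat.floor_le (by linarith)
  have hm1 : 0 < ⌊x⌋₊ := Nat.floor_pos.2 hx1
  refine ⟨⌊x⌋₊, hm1, ?_, ?_, ?_⟩
  · have : (⌊x⌋₊ : ℝ) ^ r ≤ n := hxr ▸ pow_le_pow_left₀ (by positivity) hm r
    exact_mod_cast this
  · have h1 : x ≤ 2 * ⌊x⌋₊ := by
      have := Nat.lt_floor_add_one x
      have h2 : (1 : ℝ) ≤ ⌊x⌋₊ := by exact_mod_cast hm1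
      linarith
    have : (n : ℝ) ≤ 2 ^ r * (⌊x⌋₊ : ℝ) ^ r := by
      rw [← mul_pow, ← hxr]
      exact pow_le_pow_left₀ (by linarith) h1 r
    exact_mod_cast this
  · calc (n : ℝ) * ⌊x⌋₊ ≤ n * x := mul_le_mul_of_nonneg_left hm hn'.le
      _ = (n : ℝ) ^ (((r : ℝ) + 1) / r) := by
        rw [add_div, div_self hr', Real.rpow_add hn', Real.rpow_one]

theorem exists_saturated_graph_of_card {ι S T J : Type} [Fintype ι] [Fintype S] [Fintype T]
    [Fintype J] {r n m K L q : ℕ} {ε : ℝ} (hr : 2 ≤ r) (hι : Fintype.card ι = r)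
    (hS : Fintype.card S = K) (hT : Fintype.card T + 1 = r) (hJ : Fintype.card J = m)
    (hL : Fintype.card (S × T × J) = L) (hq : q = 2 ^ r * m) (hm : 0 < m) (hmr : m ^ r ≤ n)
    (hnm : n ≤ 2 ^ r * m ^ r) (hε : 0 < ε) (hK : 2 ≤ ε / 2 ^ r * ε * K) (hLn : L ≤ n)
    (hclass : L + (r + 1) * (K * q) < n / r) (hlarge : ((r + 1) * (K * q) : ℕ) < ε * n) :
    ∃ G : SimpleGraph (Fin n), Saturated (r + 1) G ∧
      turanEdges r n ≤ #G.edgeFinset + (L * n + n * (K * q)) ∧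
      ∀ P : Fin r → Finset (Fin n), (∀ i j, i ≠ j → ∀ a ∈ P i, ∀ b ∈ P j, G.Adj a b) →
        ¬ ∀ i, r * (ε * n) + L ≤ #(P i) := by
  have hΓ : Fintype.card (T → J) = m ^ (r - 1) := by
    rw [Fintype.card_fun, hJ, ← hT, Nat.add_sub_cancel]
  have hmm : m * m ^ (r - 1) = m ^ r := by
    rw [← pow_succ', Nat.sub_add_cancel (by omega)]
  obtain ⟨φ, hφ⟩ := exists_map_card_fiber_le (Γ := T → J) (n := n) (q := q)
    (by rw [hΓ, hq, mul_assoc, hmm]; exact hnm)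
  obtain ⟨f, hf⟩ := exists_labelling_hitting (Γ := T → J) (S := S) (n := n)
    (η := ε / 2 ^ r) (ε := ε) (by rw [hΓ]; positivity)
    (by rw [hΓ]; exact (Nat.pow_le_pow_right hm (by omega)).trans hmr) (by positivity)
    (by rw [hS]; exact hK)
  obtain ⟨d, hd, hdc⟩ := exists_partial_labelling (α := S × T × J) (n := n) (hL.trans_le hLn)
  rw [hL] at hdc
  let e := Fintype.equivFinOfCardEq hι
  let D : LabelledColouring (Fin n) ι S T J :=
    { c := fun v => e.symm ⟨v % r, Nat.mod_lt _ (by omega)⟩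
      c₀ := e.symm ⟨0, by omega⟩
      c₁ := e.symm ⟨1, by omega⟩
      ne := by simp
      φ := φ
      f := f
      d := d }
  obtain ⟨G, hle, hsat⟩ := exists_saturated_ge (D.graph_cliqueFree hι hT)
  have hB : ∀ v, #{u | D.Clash u v} ≤ K * q := by
    intro v
    have hsub : ({u | D.Clash u v} : Finset (Fin n)) ⊆
        univ.biUnion fun s : S => {u | φ u = f v s} := fun u hu => by
      obtain ⟨-, -, s, hs⟩ := (mem_filter.1 hu).2
      exact mem_biUnion.2 ⟨s, mem_univ _, by simpa using hs⟩
    refine (card_le_card hsub).trans ((card_biUnion_le_card_mul _ _ q fun s _ => hφ _).trans ?_)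
    rw [card_univ, hS]
  refine ⟨G, hsat, ?_, fun P hP hPc => ?_⟩
  · have h1 := LabelledColouring.card_edgeFinset_le_add hB (H := turanGraph n r)
      fun u v huv h => huv (by simpa [D] using h)
    rw [Fintype.card_fin] at h1
    have h2 : #D.graph.edgeFinset ≤ #G.edgeFinset := card_le_card (edgeFinset_mono hle)
    have h3 : #{v | D.d v ≠ none} * n ≤ L * n := Nat.mul_le_mul_right _ hdc
    unfold turanEdges
    omega
  · have hclass' : ∀ k, (r + 1) * (K * q) < #{v | D.d v = none ∧ D.c v = k} := by
      intro k
      have h1 : n / r ≤ #{v | D.d v = none ∧ D.c v = k} + #{v | D.d v ≠ none} := by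
        refine (div_le_card_mod_eq n (e k).2).trans
          ((card_le_card ?_).trans (card_union_le _ _))
        intro v hv
        have hvk : D.c v = k := by
          rw [← e.symm_apply_apply k]
          exact congrArg e.symm (Fin.ext (mem_filter.1 hv).2)
        by_cases hdv : D.d v = none <;> simp [hdv, hvk]
      have h2 : #{v | D.d v ≠ none} ≤ L := hdc
      omega
    have hclash : ∀ X Y : Finset (Fin n), ε * n ≤ #X → ε * n ≤ #Y →
        ∃ a ∈ X, ∃ b ∈ Y, ∃ s, D.φ a = D.f b s := by
      intro X Y hX hY
      have h1 : #X ≤ q * #(X.image φ) := by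
        refine card_le_mul_card_image _ _ fun x _ => (card_le_card fun v hv => ?_).trans (hφ x)
        simpa using (mem_filter.1 hv).2
      have h2 : ε / 2 ^ r * Fintype.card (T → J) ≤ #(X.image φ) := by
        rw [hΓ]
        have hq0 : (0 : ℝ) < q := by rw [hq]; positivity
        have h3 : (q : ℝ) * (ε / 2 ^ r * (m ^ (r - 1) : ℕ)) = ε * (m ^ r : ℕ) := by
          rw [← hmm, hq]
          push_cast
          field_simp
        have h4 : ((m ^ r : ℕ) : ℝ) ≤ n := by exact_mod_cast hmr
        have h5 : (#X : ℝ) ≤ q * #(X.image φ) := by exact_mod_cast h1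
        refine le_of_mul_le_mul_left ?_ hq0
        have h6 := mul_le_mul_of_nonneg_left h4 hε.le
        linarith
      obtain ⟨b, hb, s, hs⟩ := hf _ Y h2 hY
      obtain ⟨a, ha, has⟩ := mem_image.1 hs
      exact ⟨a, ha, b, hb, s, has⟩
    refine LabelledColouring.not_exists_complete_multipartite hι hT hle hsat.1 hd hB hclass'
      hclash hlarge P hP fun i => le_trans ?_ (hPc i)
    have h4 : (#{v | D.d v ≠ none} : ℝ) ≤ L := by exact_mod_cast hdc
    linarith

/-- Theorem 3. For `r ≥ 2` and `δ > 0` there is a constant `C = C(r, δ)`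
such that for all sufficiently large `n` there is an `(r+1)`-saturated graph `G` on `n`
vertices with `e(G) ≥ t_r(n) − C n^{(r+1)/r}` containing no copy of the Turán graph
`T_r(⌊δrn⌋)` as a (not necessarily induced) subgraph. -/
theorem no_large_turan_subgraph (r : ℕ) (hr : 2 ≤ r) (δ : ℝ) (hδ : 0 < δ) :
    ∃ C : ℝ, 0 < C ∧ ∃ N : ℕ, ∀ n : ℕ, N ≤ n →
      ∃ G : SimpleGraph (Fin n), Saturated (r + 1) G ∧
        (turanEdges r n : ℝ) - C * (n : ℝ) ^ (((r : ℝ) + 1) / (r : ℝ))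
          ≤ (G.edgeFinset.card : ℝ) ∧
        ¬ ∃ f : Fin (⌊δ * r * n⌋₊) → Fin n, Function.Injective f ∧
            ∀ a b : Fin (⌊δ * r * n⌋₊),
              (SimpleGraph.turanGraph (⌊δ * r * n⌋₊) r).Adj a b → G.Adj (f a) (f b) := by
  have hr2 : (2 : ℝ) ≤ r := by exact_mod_cast hr
  have hr0 : (0 : ℝ) < r := by linarith
  obtain ⟨ε, hε0, hε⟩ : ∃ ε : ℝ, 0 < ε ∧ r * ε = δ / 2 :=
    ⟨δ / (2 * r), by positivity, by field_simp⟩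
  obtain ⟨K, hK⟩ : ∃ K : ℕ, 2 ≤ ε / 2 ^ r * ε * K := by
    obtain ⟨K, hK⟩ := exists_nat_ge (2 / (ε / 2 ^ r * ε))
    refine ⟨K, ?_⟩
    rw [div_le_iff₀ (by positivity)] at hK
    linarith
  obtain ⟨c, hc⟩ : ∃ c : ℕ, c = K * (r - 1) + (r + 1) * (K * 2 ^ r) + 2 := ⟨_, rfl⟩
  obtain ⟨N, hN0, hN⟩ := exists_forall_mul_add_one_lt c
    (lt_min hε0 (lt_min (one_div_pos.2 hr0) one_pos))
  refine ⟨c, by rw [hc]; positivity, N, fun n hn => ?_⟩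
  have hn0 : 0 < n := by omega
  obtain ⟨m, hm0, hmr, hnm, hnm'⟩ := exists_nat_root (r := r) (by omega) hn0
  have hsmall := hN n m hn hm0 ((Nat.pow_le_pow_right hm0 hr).trans hmr)
  have hnR : (0 : ℝ) < n := by exact_mod_cast hn0
  have hs1 : (c : ℝ) * (m + 1) < ε * n :=
    hsmall.trans_le (mul_le_mul_of_nonneg_right (min_le_left _ _) hnR.le)
  have hs2 : (c : ℝ) * (m + 1) < 1 / r * n := hsmall.trans_le
    (mul_le_mul_of_nonneg_right ((min_le_right _ _).trans (min_le_left _ _)) hnR.le)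
  have hs3 : (c : ℝ) * (m + 1) < 1 * n := hsmall.trans_le
    (mul_le_mul_of_nonneg_right ((min_le_right _ _).trans (min_le_right _ _)) hnR.le)
  obtain ⟨q, hq⟩ : ∃ q : ℕ, q = 2 ^ r * m := ⟨_, rfl⟩
  obtain ⟨L, hL⟩ : ∃ L : ℕ, L = K * (r - 1) * m := ⟨_, rfl⟩
  obtain ⟨B, hB⟩ : ∃ B : ℕ, B = (r + 1) * (K * q) := ⟨_, rfl⟩
  have hcm : L + B + 2 ≤ c * (m + 1) := by
    have : c * (m + 1) = L + B + 2 + 2 * m + (K * (r - 1) + (r + 1) * (K * 2 ^ r)) := by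
      rw [hc, hL, hB, hq]; ring
    omega
  have hcmR : (L : ℝ) + B + 2 ≤ c * (m + 1) := by exact_mod_cast hcm
  have hL0 : (0 : ℝ) ≤ L := Nat.cast_nonneg _
  have hB0 : (0 : ℝ) ≤ B := Nat.cast_nonneg _
  have hfloor : ∀ x : ℝ, x / r < (⌊x⌋₊ / r : ℕ) + 1 := fun x => by
    rw [← Nat.floor_div_natCast]
    exact Nat.lt_floor_add_one _
  have hclass : L + (r + 1) * (K * q) < n / r := by
    have h1 := hfloor n
    rw [Nat.floor_natCast] at h1
    have h2 : ((L + B + 2 : ℕ) : ℝ) < (n / r + 1 : ℕ) := by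
      push_cast
      rw [one_div_mul_eq_div] at hs2
      linarith
    have h3 : L + B + 2 < n / r + 1 := by exact_mod_cast h2
    omega
  obtain ⟨G, hsat, hedge, hG⟩ := exists_saturated_graph_of_card (ι := Fin r) (S := Fin K)
    (T := Fin (r - 1)) (J := Fin m) (L := L) hr (Fintype.card_fin r) (Fintype.card_fin K)
    (by rw [Fintype.card_fin]; omega) (Fintype.card_fin m) (by simp [hL, mul_assoc]) hq hm0 hmr
    hnm hε0 hK
    (by
      have : (L : ℝ) ≤ n := by linarith
      exact_mod_cast this)
    hclass (by rw [← hB]; linarith)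
  refine ⟨G, hsat, ?_, ?_⟩
  · have h1 : L * n + n * (K * q) ≤ n * m * c := by
      have : n * m * c = L * n + n * (K * q) + n * m * (r * (K * 2 ^ r) + 2) := by
        rw [hc, hL, hq]; ring
      omega
    have h2 : (turanEdges r n : ℝ) ≤ #G.edgeFinset + n * m * c := by
      exact_mod_cast hedge.trans (Nat.add_le_add_left h1 _)
    have h3 := mul_le_mul_of_nonneg_right hnm' (Nat.cast_nonneg (α := ℝ) c)
    linarith
  · rintro ⟨g, hg, hgadj⟩
    refine hG (fun i => ({a | (a : ℕ) % r = i} : Finset (Fin ⌊δ * r * n⌋₊)).image g)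
      (fun i j hij a ha b hb => ?_) fun i => ?_
    · obtain ⟨a', ha', rfl⟩ := mem_image.1 ha
      obtain ⟨b', hb', rfl⟩ := mem_image.1 hb
      refine hgadj a' b' fun h => hij (Fin.ext ?_)
      exact (mem_filter.1 ha').2.symm.trans (h.trans (mem_filter.1 hb').2)
    · rw [card_image_of_injective _ hg]
      have h1 : ((⌊δ * r * n⌋₊ / r : ℕ) : ℝ) ≤
          #{a : Fin ⌊δ * r * n⌋₊ | (a : ℕ) % r = i} := by
        exact_mod_cast div_le_card_mod_eq ⌊δ * r * n⌋₊ i.2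
      have h2 := hfloor (δ * r * n)
      rw [show δ * r * n / r = δ * n by field_simp] at h2
      have h3 : r * (ε * n) = δ * n / 2 := by rw [← mul_assoc, hε]; ring
      have h4 : 2 * (ε * n) ≤ r * (ε * n) := mul_le_mul_of_nonneg_right hr2 (by positivity)
      linarith
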